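/- arXiv:1709.04578 — 9 statements merged into one kernel-verified Lean document; each statement's English description precedes it below -/
import Mathlib

section
/- Let k be a commutative ring, R a unital associative k-algebra, and X a set. Then there exist a left R-module F, a k-linear map p : F → F, and a map j : X → F with the following universal property: for every left R-module M equipped with a k-linear map q : M → M and every map f : X → M, there exists a unique R-linear map φ : F → M satisfying φ ∘ p = q ∘ φ and φ ∘ j = f. (That is, the free left operated R-module on X exists.) -/
universe u

namespace FreeOp

/-- Relations making `R → A` a `k`-algebra homomorphism; `none` is the free operator variable. -/
inductive Rel (k R : Type u) [CommRing k] [Ring R] [Algebra k R] :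
    FreeAlgebra k (Option R) → FreeAlgebra k (Option R) → Prop
  | add (r s : R) : Rel k R (FreeAlgebra.ι k (some (r + s)))
      (FreeAlgebra.ι k (some r) + FreeAlgebra.ι k (some s))
  | mul (r s : R) : Rel k R (FreeAlgebra.ι k (some (r * s)))
      (FreeAlgebra.ι k (some r) * FreeAlgebra.ι k (some s))
  | scalar (c : k) : Rel k R (FreeAlgebra.ι k (some (algebraMap k R c)))
      (algebraMap k (FreeAlgebra k (Option R)) c)

/-- The free product of `R` and `k[t]`. -/
abbrev A (k R : Type u) [CommRing k] [Ring R] [Algebra k R] : Type u := RingQuot (Rel k R)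

section
variable (k R X : Type u) [CommRing k] [Ring R] [Algebra k R]

/-- The generators. -/
noncomputable def gen (o : Option R) : A k R := RingQuot.mkAlgHom k (Rel k R) (FreeAlgebra.ι k o)

/-- The inclusion of `R`. -/
noncomputable def incl : R →ₐ[k] A k R :=
  have h1 : ∀ c : k, gen k R (some (algebraMap k R c)) = algebraMap k (A k R) c := fun c => by
    have := RingQuot.mkAlgHom_rel k (Rel.scalar (R := R) c)
    rwa [AlgHom.commutes] at this
  { toFun := fun r => gen k R (some r)
    map_one' := by simpa using h1 1
    map_zero' := by simpa using h1 0
    map_add' := fun r s => by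
      simpa [gen] using RingQuot.mkAlgHom_rel k (Rel.add (k := k) r s)
    map_mul' := fun r s => by
      simpa [gen] using RingQuot.mkAlgHom_rel k (Rel.mul (k := k) r s)
    commutes' := h1 }

variable {R} in
theorem incl_apply (r : R) : incl k R r = gen k R (some r) := rfl

theorem A_induction {C : A k R → Prop} (hk : ∀ c, C (algebraMap k _ c)) (hr : ∀ r, C (incl k R r))
    (ht : C (gen k R none)) (hadd : ∀ a b, C a → C b → C (a + b))
    (hmul : ∀ a b, C a → C b → C (a * b)) (a : A k R) : C a := by
  obtain ⟨b, rfl⟩ := RingQuot.mkAlgHom_surjective k (Rel k R) a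
  induction b using FreeAlgebra.induction with
  | grade0 c => rw [AlgHom.commutes]; exact hk c
  | grade1 o => cases o with
    | none => exact ht
    | some r => exact hr r
  | mul a b ha hb => rw [map_mul]; exact hmul _ _ ha hb
  | add a b ha hb => rw [map_add]; exact hadd _ _ ha hb

variable {M : Type u} [AddCommGroup M] [Module k M] [Module R M] [IsScalarTower k R M]

/-- The action on an operated module. -/
noncomputable def act (q : M →ₗ[k] M) : A k R →ₐ[k] Module.End k M :=
  RingQuot.liftAlgHom k ⟨FreeAlgebra.lift k (fun o => o.elim q (fun r => Algebra.lsmul k k M r)), by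
    intro x y h
    cases h with
    | add r s => simp
    | mul r s => simp
    | scalar c => simp⟩

theorem act_incl (q : M →ₗ[k] M) (r : R) (m : M) : act k R q (incl k R r) m = r • m := by
  simp [act, incl_apply, gen]

theorem act_none (q : M →ₗ[k] M) : act k R q (gen k R none) = q := by
  simp [act, gen]

/-- The free operated module. -/
def F : Type u := X →₀ A k R

noncomputable instance : AddCommGroup (F k R X) := inferInstanceAs (AddCommGroup (X →₀ A k R))
noncomputable instance : Module k (F k R X) := inferInstanceAs (Module k (X →₀ A k R))
noncomputable instance : Module (A k R) (F k R X) := inferInstanceAs (Module (A k R) (X →₀ A k R))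
instance : IsScalarTower k (A k R) (F k R X) :=
  inferInstanceAs (IsScalarTower k (A k R) (X →₀ A k R))
noncomputable instance : Module R (F k R X) := Module.compHom _ (incl k R).toRingHom

theorem smul_F (r : R) (v : F k R X) : r • v = incl k R r • v := rfl

instance : IsScalarTower k R (F k R X) := ⟨fun c r v => by
  rw [smul_F, smul_F, map_smul, smul_assoc]⟩

/-- The basis elements. -/
noncomputable def j (x : X) : F k R X := (Finsupp.single x 1 : X →₀ A k R)

theorem F_induction {C : F k R X → Prop} (h0 : C 0) (hadd : ∀ v w, C v → C w → C (v + w))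
    (hj : ∀ (a : A k R) x, C (a • j k R X x)) (v : F k R X) : C v := by
  refine Finsupp.induction_linear (motive := C) v h0 hadd ?_
  intro x a
  have h := hj a x
  have e : a • j k R X x = (Finsupp.single x a : X →₀ A k R) := by
    refine (Finsupp.smul_single a x (1 : A k R)).trans ?_
    simp
  rwa [e] at h

/-- The induced map, over `k`. -/
noncomputable def ext (q : M →ₗ[k] M) (f : X → M) : F k R X →ₗ[k] M :=
  Finsupp.lsum (M := A k R) k (fun x => (act k R q).toLinearMap.flip (f x))

theorem ext_j (q : M →ₗ[k] M) (f : X → M) (a : A k R) (x : X) :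
    ext k R X q f (a • j k R X x) = act k R q a (f x) := by
  have e : a • j k R X x = (Finsupp.single x a : X →₀ A k R) := by
    refine (Finsupp.smul_single a x (1 : A k R)).trans ?_
    simp
  rw [e]
  refine (Finsupp.lsum_single (M := A k R) k _ x a).trans ?_
  simp

theorem ext_smul (q : M →ₗ[k] M) (f : X → M) (a : A k R) (v : F k R X) :
    ext k R X q f (a • v) = act k R q a (ext k R X q f v) := by
  induction v using F_induction with
  | h0 => simp
  | hadd v w hv hw => simp [smul_add, hv, hw]
  | hj b x => rw [← mul_smul, ext_j, ext_j, map_mul]; rfl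

theorem hom_smul (q : M →ₗ[k] M) (φ : F k R X →ₗ[R] M)
    (h : ∀ v, φ (gen k R none • v) = q (φ v)) (a : A k R) :
    ∀ v, φ (a • v) = act k R q a (φ v) := by
  induction a using A_induction with
  | hk c =>
    intro v
    have e : algebraMap k (A k R) c • v = algebraMap k R c • v := by
      rw [smul_F, AlgHom.commutes]
    rw [e, map_smul, AlgHom.commutes]
    simp
  | hr r => intro v; rw [act_incl, ← smul_F, map_smul]
  | ht => intro v; rw [act_none, h]
  | hadd a b ha hb => intro v; simp [add_smul, ha, hb]
  | hmul a b ha hb => intro v; rw [mul_smul, ha, hb, map_mul]; rfl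

end

end FreeOp

/-- Let `k` be a commutative ring, `R` a unital associative `k`-algebra and `X`
a set.  Then the free left operated `R`-module on `X` exists: there are a left `R`-module `F`
(which is also a `k`-module compatibly), a `k`-linear map `p : F → F` and a map `j : X → F` such
that for every left `R`-module `M` with a `k`-linear map `q : M → M` and every map `f : X → M`
there is a unique `R`-linear map `φ : F → M` with `φ ∘ p = q ∘ φ` and `φ ∘ j = f`. -/
theorem exists_free_operated_module
    (k R X : Type u) [CommRing k] [Ring R] [Algebra k R] :
    ∃ (F : Type u) (_ : AddCommGroup F) (_ : Module k F) (_ : Module R F)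
      (_ : IsScalarTower k R F) (p : F →ₗ[k] F) (j : X → F),
      ∀ (M : Type u) (_ : AddCommGroup M) (_ : Module k M) (_ : Module R M)
        (_ : IsScalarTower k R M) (q : M →ₗ[k] M) (f : X → M),
        ∃! φ : F →ₗ[R] M, (∀ v : F, φ (p v) = q (φ v)) ∧ ∀ x : X, φ (j x) = f x := by
  refine ⟨FreeOp.F k R X, inferInstance, inferInstance, inferInstance, inferInstance,
    Algebra.lsmul k k _ (FreeOp.gen k R none), FreeOp.j k R X, ?_⟩
  intro M _ _ _ _ q f
  refine ⟨{ FreeOp.ext k R X q f with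
    map_smul' := fun r v => ?_ }, ⟨fun v => ?_, fun x => ?_⟩, ?_⟩
  · exact (FreeOp.ext_smul k R X q f (FreeOp.incl k R r) v).trans (FreeOp.act_incl k R q r _)
  · refine (FreeOp.ext_smul k R X q f (FreeOp.gen k R none) v).trans ?_
    rw [FreeOp.act_none]
    rfl
  · have h := FreeOp.ext_j k R X q f 1 x
    rw [one_smul, map_one] at h
    exact h
  · rintro ψ ⟨h1, h2⟩
    ext v
    change ψ v = FreeOp.ext k R X q f v
    induction v using FreeOp.F_induction with
    | h0 => simp
    | hadd v w hv hw => rw [map_add, map_add, hv, hw]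
    | hj a x => rw [FreeOp.ext_j, FreeOp.hom_smul k R X q ψ h1, h2]
end

section
/- Let (R,P) be a Rota-Baxter k-algebra of weight λ and X a set. Then there exist a left (R,P)-module (F,p) and a map j : X → F with the following universal property: for every left (R,P)-module (M,q) and every map f : X → M, there exists a unique left (R,P)-module homomorphism φ : (F,p) → (M,q) (i.e. an R-linear map with φ ∘ p = q ∘ φ) satisfying φ ∘ j = f. (That is, the free left (R,P)-module on X exists.) -/
universe u


namespace RBFree

/-- Relations defining the ring of Rota-Baxter operators. -/
inductive Rel (k R : Type u) [CommRing k] [Ring R] [Algebra k R] (lam : k) (P : R →ₗ[k] R) :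
    FreeAlgebra k (Option R) → FreeAlgebra k (Option R) → Prop
  | add (r s : R) : Rel k R lam P (FreeAlgebra.ι k (some (r + s)))
      (FreeAlgebra.ι k (some r) + FreeAlgebra.ι k (some s))
  | mul (r s : R) : Rel k R lam P (FreeAlgebra.ι k (some (r * s)))
      (FreeAlgebra.ι k (some r) * FreeAlgebra.ι k (some s))
  | scal (c : k) : Rel k R lam P (FreeAlgebra.ι k (some (algebraMap k R c)))
      (algebraMap k _ c)
  | rb (r : R) : Rel k R lam P
      (FreeAlgebra.ι k (some (P r)) * FreeAlgebra.ι k none)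
      (FreeAlgebra.ι k none * FreeAlgebra.ι k (some (P r)) +
        FreeAlgebra.ι k none * (FreeAlgebra.ι k (some r) * FreeAlgebra.ι k none) +
        lam • (FreeAlgebra.ι k none * FreeAlgebra.ι k (some r)))

theorem exists_ring (k R : Type u) [CommRing k] [Ring R] [Algebra k R] (lam : k)
    (P : R →ₗ[k] R) :
    ∃ (A : Type u) (_ : Ring A) (_ : Algebra k A) (i : R →ₐ[k] A) (Q : A),
      (∀ r, i (P r) * Q = Q * i (P r) + Q * (i r * Q) + lam • (Q * i r)) ∧
      (∀ (B : Type u) (_ : Ring B) (_ : Algebra k B) (a : R →ₐ[k] B) (q : B),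
        (∀ r, a (P r) * q = q * a (P r) + q * (a r * q) + lam • (q * a r)) →
        ∃ ρ : A →ₐ[k] B, (∀ r, ρ (i r) = a r) ∧ ρ Q = q) ∧
      (∀ C : A → Prop, (∀ c, C (algebraMap k A c)) → (∀ r, C (i r)) → C Q →
        (∀ a b, C a → C b → C (a * b)) → (∀ a b, C a → C b → C (a + b)) → ∀ a, C a) := by
  let π := RingQuot.mkAlgHom k (Rel k R lam P)
  have hπ : ∀ {x y}, Rel k R lam P x y → π x = π y := fun h => RingQuot.mkAlgHom_rel k h
  have hs : ∀ c : k, π (FreeAlgebra.ι k (some (algebraMap k R c))) = algebraMap k _ c :=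
    fun c => by rw [hπ (Rel.scal c)]; exact π.commutes c
  let i : R →ₐ[k] RingQuot (Rel k R lam P) :=
    { toFun := fun r => π (FreeAlgebra.ι k (some r))
      map_one' := by simpa using hs 1
      map_zero' := by simpa using hs 0
      map_mul' := fun r s => by rw [hπ (Rel.mul r s), map_mul]
      map_add' := fun r s => by rw [hπ (Rel.add r s), map_add]
      commutes' := hs }
  refine ⟨RingQuot (Rel k R lam P), inferInstance, inferInstance, i,
    π (FreeAlgebra.ι k none), ?_, ?_, ?_⟩
  · intro r
    have := hπ (Rel.rb (lam := lam) (P := P) r)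
    simp only [map_mul, map_add, map_smul] at this
    exact this
  · intro B _ _ a q h
    let g : Option R → B := fun o => o.elim q a
    refine ⟨RingQuot.liftAlgHom k ⟨FreeAlgebra.lift k g, ?_⟩, ?_, ?_⟩
    · intro x y hxy
      induction hxy with
      | add r s => simp [g]
      | mul r s => simp [g]
      | scal c => simp [g]
      | rb r => simpa [g] using h r
    · intro r
      change RingQuot.liftAlgHom k _ (RingQuot.mkAlgHom k _ _) = _
      rw [RingQuot.liftAlgHom_mkAlgHom_apply]
      simp [g]
    · change RingQuot.liftAlgHom k _ (RingQuot.mkAlgHom k _ _) = _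
      rw [RingQuot.liftAlgHom_mkAlgHom_apply]
      simp [g]
  · intro C h1 h2 h3 h4 h5 a
    obtain ⟨x, rfl⟩ := RingQuot.mkAlgHom_surjective k (Rel k R lam P) a
    change C (π x)
    induction x using FreeAlgebra.induction with
    | grade0 c => rw [π.commutes]; exact h1 c
    | grade1 o => cases o with
      | none => exact h3
      | some r => exact h2 r
    | mul a b ha hb => rw [map_mul]; exact h4 _ _ ha hb
    | add a b ha hb => rw [map_add]; exact h5 _ _ ha hb

end RBFree

/-- Let `(R,P)` be a Rota-Baxter `k`-algebra of weight `λ` and `X` a set.  Then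
the free left `(R,P)`-module on `X` exists: there are a left `(R,P)`-module `(F,p)` and a map
`j : X → F` such that for every left `(R,P)`-module `(M,q)` and every map `f : X → M` there is a
unique left `(R,P)`-module homomorphism `φ : (F,p) → (M,q)` with `φ ∘ j = f`. -/
theorem exists_free_rotaBaxter_module
    (k R : Type u) [CommRing k] [Ring R] [Algebra k R] (lam : k)
    (P : R →ₗ[k] R)
    (hP : ∀ r s : R, P r * P s = P (r * P s) + P (P r * s) + lam • P (r * s))
    (X : Type u) :
    ∃ (F : Type u) (_ : AddCommGroup F) (_ : Module k F) (_ : Module R F)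
      (_ : IsScalarTower k R F) (p : F →ₗ[k] F) (j : X → F),
      (∀ (r : R) (v : F), P r • p v = p (P r • v) + p (r • p v) + lam • p (r • v)) ∧
      ∀ (M : Type u) (_ : AddCommGroup M) (_ : Module k M) (_ : Module R M)
        (_ : IsScalarTower k R M) (q : M →ₗ[k] M),
        (∀ (r : R) (m : M), P r • q m = q (P r • m) + q (r • q m) + lam • q (r • m)) →
        ∀ f : X → M,
          ∃! φ : F →ₗ[R] M, (∀ v : F, φ (p v) = q (φ v)) ∧ ∀ x : X, φ (j x) = f x := by
  obtain ⟨A, _, _, i, Q, hQ, hlift, hind⟩ := RBFree.exists_ring k R lam P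
  letI modR : Module R (X →₀ A) := Module.compHom (X →₀ A) i.toRingHom
  have hsm : ∀ (r : R) (v : X →₀ A), r • v = i r • v := fun _ _ => rfl
  have tower : IsScalarTower k R (X →₀ A) := ⟨fun c r v => by
    rw [hsm, hsm, map_smul, smul_assoc]⟩
  refine ⟨X →₀ A, inferInstance, inferInstance, modR, tower,
    Algebra.lsmul k k (X →₀ A) Q, fun x => Finsupp.single x 1, ?_, ?_⟩
  · intro r v
    simp only [Algebra.lsmul_coe, hsm, ← mul_smul, hQ, add_smul, smul_assoc]
  · intro M _ _ _ _ q hq f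
    obtain ⟨ρ, hρ, hρQ⟩ := hlift (Module.End k M) inferInstance inferInstance
      (Algebra.lsmul k k M) q (by
        intro r
        ext m
        simpa using hq r m)
    letI modA : Module A M := Module.compHom M ρ.toRingHom
    have hA : ∀ (a : A) (m : M), a • m = ρ a m := fun _ _ => rfl
    let φ₀ : (X →₀ A) →ₗ[A] M := Finsupp.linearCombination A f
    let φ : (X →₀ A) →ₗ[R] M :=
      { toFun := φ₀
        map_add' := φ₀.map_add
        map_smul' := fun r v => by
          rw [hsm, φ₀.map_smul, hA, hρ]; rfl }
    refine ⟨φ, ⟨?_, ?_⟩, ?_⟩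
    · intro v
      change φ₀ (Q • v) = q (φ₀ v)
      rw [φ₀.map_smul, hA, hρQ]
    · intro x
      change φ₀ (Finsupp.single x 1) = f x
      simp [φ₀]
    · rintro ψ ⟨h1, h2⟩
      have key : ∀ a : A, ∀ v, ψ (a • v) = ρ a (ψ v) := by
        apply hind
        · intro c v
          have : algebraMap k A c • v = (algebraMap k R c) • v := by
            rw [hsm, i.commutes]
          rw [this, ψ.map_smul, ρ.commutes, algebraMap_smul]; rfl
        · intro r v
          rw [← hsm, ψ.map_smul, hρ]; rfl
        · intro v
          rw [hρQ]; exact h1 v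
        · intro a b ha hb v
          rw [mul_smul, ha, hb, map_mul]; rfl
        · intro a b ha hb v
          rw [add_smul, map_add, ha, hb, map_add]; rfl
      let ψ₀ : (X →₀ A) →ₗ[A] M :=
        { toFun := ψ
          map_add' := ψ.map_add
          map_smul' := key }
      have : ψ₀ = φ₀ := by
        apply Finsupp.lhom_ext'
        intro x
        apply LinearMap.ext_ring
        change ψ (Finsupp.single x 1) = φ₀ (Finsupp.single x 1)
        rw [h2]
        simp [φ₀]
      ext1 v
      exact LinearMap.congr_fun this v
end

section
/- Let (R,P) be a Rota-Baxter k-algebra of weight λ. Then every left (R,P)-module is a quotient of a free left (R,P)-module: for every left (R,P)-module (M,q) there exist a set X, a free left (R,P)-module (F,p) on X (a left (R,P)-module with a map j : X → F satisfying the universal property that every map from X into a left (R,P)-module extends uniquely to a left (R,P)-module homomorphism from F), and a surjective left (R,P)-module homomorphism (F,p) → (M,q). -/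
universe u

/-- Defining relations of the algebra generated by `R` (`some r`) and an operator (`none`). -/
inductive RBRel {k R : Type u} [CommRing k] [Ring R] [Algebra k R] (lam : k) (P : R →ₗ[k] R) :
    FreeAlgebra k (Option R) → FreeAlgebra k (Option R) → Prop
  | add (r s : R) : RBRel lam P (FreeAlgebra.ι k (some (r + s)))
      (FreeAlgebra.ι k (some r) + FreeAlgebra.ι k (some s))
  | mul (r s : R) : RBRel lam P (FreeAlgebra.ι k (some (r * s)))
      (FreeAlgebra.ι k (some r) * FreeAlgebra.ι k (some s))
  | alg (c : k) : RBRel lam P (FreeAlgebra.ι k (some (algebraMap k R c)))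
      (algebraMap k _ c)
  | rb (r : R) : RBRel lam P
      (FreeAlgebra.ι k (some (P r)) * FreeAlgebra.ι k none)
      (FreeAlgebra.ι k none * FreeAlgebra.ι k (some (P r))
        + FreeAlgebra.ι k none * FreeAlgebra.ι k (some r) * FreeAlgebra.ι k none
        + lam • (FreeAlgebra.ι k none * FreeAlgebra.ι k (some r)))

/-- The universal enveloping algebra of a Rota-Baxter algebra. -/
theorem exists_RB_env {k R : Type u} [CommRing k] [Ring R] [Algebra k R] (lam : k)
    (P : R →ₗ[k] R) :
    ∃ (A : Type u) (_ : Ring A) (_ : Algebra k A) (i : R →ₐ[k] A) (Q : A),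
      (∀ r, i (P r) * Q = Q * i (P r) + Q * i r * Q + lam • (Q * i r)) ∧
      (∀ (B : Type u) (_ : Ring B) (_ : Algebra k B) (g : R →ₐ[k] B) (T : B),
        (∀ r, g (P r) * T = T * g (P r) + T * g r * T + lam • (T * g r)) →
        ∃ ρ : A →ₐ[k] B, (∀ r, ρ (i r) = g r) ∧ ρ Q = T) ∧
      (∀ C : A → Prop, (∀ c : k, C (algebraMap k A c)) → (∀ r, C (i r)) → C Q →
        (∀ a b, C a → C b → C (a + b)) → (∀ a b, C a → C b → C (a * b)) → ∀ a, C a) := by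
  let π := RingQuot.mkAlgHom k (RBRel lam P)
  let i : R →ₐ[k] RingQuot (RBRel lam P) :=
    { toFun := fun r => π (FreeAlgebra.ι k (some r))
      map_one' := by
        have := RingQuot.mkAlgHom_rel k (RBRel.alg (lam := lam) (P := P) 1)
        simpa using this
      map_zero' := by
        have := RingQuot.mkAlgHom_rel k (RBRel.alg (lam := lam) (P := P) 0)
        simpa using this
      map_add' := fun r s => by
        have := RingQuot.mkAlgHom_rel k (RBRel.add (lam := lam) (P := P) r s)
        simpa using this
      map_mul' := fun r s => by
        have := RingQuot.mkAlgHom_rel k (RBRel.mul (lam := lam) (P := P) r s)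
        simpa using this
      commutes' := fun c => by
        have := RingQuot.mkAlgHom_rel k (RBRel.alg (lam := lam) (P := P) c)
        rw [AlgHom.commutes] at this
        exact this }
  have hi : ∀ r, i r = π (FreeAlgebra.ι k (some r)) := fun _ => rfl
  refine ⟨RingQuot (RBRel lam P), inferInstance, inferInstance, i,
    π (FreeAlgebra.ι k none), ?_, ?_, ?_⟩
  · intro r
    have := RingQuot.mkAlgHom_rel k (RBRel.rb (lam := lam) (P := P) r)
    rw [hi, hi, ← map_mul, ← map_mul, ← map_mul, ← map_mul, ← map_smul, ← map_add, ← map_add]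
    exact this
  · intro B _ _ g T hT
    let f : FreeAlgebra k (Option R) →ₐ[k] B :=
      FreeAlgebra.lift k (fun o => o.elim T g)
    have hf : ∀ ⦃x y⦄, RBRel lam P x y → f x = f y := by
      intro x y h
      induction h with
      | add r s => simp [f]
      | mul r s => simp [f]
      | alg c => simp [f]
      | rb r => simpa [f] using hT r
    refine ⟨RingQuot.liftAlgHom k ⟨f, hf⟩, fun r => ?_, ?_⟩
    · rw [hi, RingQuot.liftAlgHom_mkAlgHom_apply]; simp [f]
    · rw [RingQuot.liftAlgHom_mkAlgHom_apply]; simp [f]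
  · intro C h1 h2 h3 h4 h5 a
    obtain ⟨x, rfl⟩ := RingQuot.mkAlgHom_surjective k (RBRel lam P) a
    induction x using FreeAlgebra.induction with
    | grade0 c => rw [AlgHom.commutes]; exact h1 c
    | grade1 o =>
      cases o with
      | none => exact h3
      | some r => exact h2 r
    | mul a b ha hb => rw [map_mul]; exact h5 _ _ ha hb
    | add a b ha hb => rw [map_add]; exact h4 _ _ ha hb

/-- Let `(R,P)` be a Rota-Baxter `k`-algebra of weight `λ`.  Every left
`(R,P)`-module `(M,q)` is a quotient of a free left `(R,P)`-module: there exist a set `X`, a left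
`(R,P)`-module `(F,p)` with a map `j : X → F` satisfying the universal property of the free left
`(R,P)`-module on `X`, and a surjective left `(R,P)`-module homomorphism `(F,p) → (M,q)`. -/
theorem rotaBaxter_module_is_quotient_of_free
    (k R : Type u) [CommRing k] [Ring R] [Algebra k R] (lam : k)
    (P : R →ₗ[k] R)
    (hP : ∀ r s : R, P r * P s = P (r * P s) + P (P r * s) + lam • P (r * s))
    (M : Type u) [AddCommGroup M] [Module k M] [Module R M] [IsScalarTower k R M]
    (q : M →ₗ[k] M)
    (hq : ∀ (r : R) (m : M), P r • q m = q (P r • m) + q (r • q m) + lam • q (r • m)) :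
    ∃ (X : Type u) (F : Type u) (_ : AddCommGroup F) (_ : Module k F) (_ : Module R F)
      (_ : IsScalarTower k R F) (p : F →ₗ[k] F) (j : X → F),
      -- `(F,p)` is a left `(R,P)`-module:
      (∀ (r : R) (v : F), P r • p v = p (P r • v) + p (r • p v) + lam • p (r • v)) ∧
      -- `(F,p)` with `j` is free on `X`:
      (∀ (N : Type u) (_ : AddCommGroup N) (_ : Module k N) (_ : Module R N)
        (_ : IsScalarTower k R N) (pN : N →ₗ[k] N),
        (∀ (r : R) (n : N), P r • pN n = pN (P r • n) + pN (r • pN n) + lam • pN (r • n)) →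
        ∀ f : X → N,
          ∃! φ : F →ₗ[R] N, (∀ v : F, φ (p v) = pN (φ v)) ∧ ∀ x : X, φ (j x) = f x) ∧
      -- `(M,q)` is a quotient of `(F,p)`:
      ∃ π : F →ₗ[R] M, (∀ v : F, π (p v) = q (π v)) ∧ Function.Surjective π := by
  obtain ⟨A, _, _, i, Q, hQ, hlift, hind⟩ := exists_RB_env lam P
  letI modF : Module R (M →₀ A) := Module.compHom _ i.toRingHom
  have hsm : ∀ (r : R) (v : M →₀ A), r • v = i r • v := fun _ _ => rfl
  haveI tow : IsScalarTower k R (M →₀ A) := ⟨fun c r v => by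
    rw [hsm, hsm, map_smul, smul_assoc]⟩
  have key : ∀ (N : Type u) (_ : AddCommGroup N) (_ : Module k N) (_ : Module R N)
        (_ : IsScalarTower k R N) (pN : N →ₗ[k] N),
        (∀ (r : R) (n : N), P r • pN n = pN (P r • n) + pN (r • pN n) + lam • pN (r • n)) →
        ∀ f : M → N,
          ∃! φ : (M →₀ A) →ₗ[R] N, (∀ v : M →₀ A, φ (Q • v) = pN (φ v)) ∧
            ∀ x : M, φ (Finsupp.single x 1) = f x := by
    intro N _ _ _ _ pN hpN f
    obtain ⟨ρ, hρ, hρQ⟩ := hlift (Module.End k N) inferInstance inferInstance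
      (Algebra.lsmul k k N) pN (by
        intro r
        ext n
        simpa using hpN r n)
    have hρ' : ∀ r n, ρ (i r) n = r • n := fun r n => by rw [hρ]; rfl
    let φ₀ : (M →₀ A) →+ N := Finsupp.liftAddHom (fun x =>
      { toFun := fun a => ρ a (f x), map_zero' := by simp, map_add' := by simp })
    have h0 : ∀ x a, φ₀ (Finsupp.single x a) = ρ a (f x) := fun x a => by simp [φ₀]
    have hφ₀ : ∀ (a : A) v, φ₀ (a • v) = ρ a (φ₀ v) := by
      intro a v
      induction v using Finsupp.induction_linear with
      | zero => simp
      | add v w hv hw => rw [smul_add, map_add, map_add, hv, hw, map_add]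
      | single x b => rw [Finsupp.smul_single, h0, h0, smul_eq_mul, map_mul]; rfl
    refine ⟨{ toFun := φ₀, map_add' := φ₀.map_add,
              map_smul' := fun r v => by
                rw [hsm, hφ₀, hρ']; rfl }, ⟨fun v => ?_, fun x => ?_⟩, ?_⟩
    · change φ₀ _ = pN (φ₀ v)
      rw [hφ₀, hρQ]
    · change φ₀ _ = _
      rw [h0, map_one]; rfl
    · rintro ψ ⟨h1, h2⟩
      have hψ : ∀ (a : A) v, ψ (a • v) = ρ a (ψ v) := by
        intro a
        refine hind (fun a => ∀ v, ψ (a • v) = ρ a (ψ v)) ?_ ?_ ?_ ?_ ?_ a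
        · intro c v
          rw [algebraMap_smul, AlgHom.commutes, LinearMap.map_smul_of_tower]; rfl
        · intro r v
          rw [← hsm, hρ', map_smul]
        · intro v
          rw [h1, hρQ]
        · intro a b ha hb v
          rw [add_smul, map_add, ha, hb, map_add]; rfl
        · intro a b ha hb v
          rw [mul_smul, ha, hb, map_mul]; rfl
      ext v
      change ψ v = φ₀ v
      induction v using Finsupp.induction_linear with
      | zero => simp
      | add v w hv hw => rw [map_add, map_add, hv, hw]
      | single x b =>
        have : Finsupp.single x b = b • (Finsupp.single x 1 : M →₀ A) := by simp
        rw [h0, this, hψ, h2]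
  refine ⟨M, M →₀ A, inferInstance, inferInstance, modF, tow, Algebra.lsmul k k (M →₀ A) Q,
    fun x => Finsupp.single x 1, ?_, key, ?_⟩
  · intro r v
    simp only [Algebra.lsmul_coe, hsm]
    rw [← mul_smul, hQ, add_smul, add_smul, smul_assoc, mul_smul, mul_smul, mul_smul, mul_smul]
  · obtain ⟨π, ⟨h1, h2⟩, -⟩ := key M _ _ _ inferInstance q hq id
    exact ⟨π, h1, fun m => ⟨_, h2 m⟩⟩
end

section
/- Let (R,P) be a Rota-Baxter k-algebra of weight λ and X a set. Let F(X) = X →₀ R be the free left R-module on X with p̃ : F(X) → F(X) given by applying P coefficientwise, and let ι : X → F(X) send x to the basis element x. Then (F(X), p̃) is the restricted free left (R,P)-module on X: for every left (R,P)-module (M,q) and every map f : X → M whose image lies in the set of module constants MC(M) = {m ∈ M | q(rm) = P(r)m for all r ∈ R}, there exists a unique left (R,P)-module homomorphism φ : (F(X), p̃) → (M,q) (i.e. R-linear with φ ∘ p̃ = q ∘ φ) such that φ ∘ ι = f. -/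
/-- Let `(R,P)` be a Rota-Baxter `k`-algebra of weight `λ` and `X` a set.  The
free left `R`-module `F(X) = X →₀ R`, with the operator `p̃` applying `P` coefficientwise and
`ι : X → F(X)` sending `x` to the basis element `x`, is the *restricted* free left `(R,P)`-module
on `X`: for every left `(R,P)`-module `(M,q)` and every map `f : X → M` whose image lies in the
module constants `MC(M) = {m | q(r • m) = P(r) • m for all r}`, there is a unique left
`(R,P)`-module homomorphism `φ : (F(X), p̃) → (M,q)` with `φ ∘ ι = f`. -/
theorem restricted_free_rotaBaxter_module
    (k : Type*) [CommRing k] (lam : k)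
    (R : Type*) [Ring R] [Algebra k R] (P : R →ₗ[k] R)
    (hP : ∀ r s : R, P r * P s = P (r * P s) + P (P r * s) + lam • P (r * s))
    (X : Type*)
    (M : Type*) [AddCommGroup M] [Module k M] [Module R M] [IsScalarTower k R M]
    (q : M →ₗ[k] M)
    (hq : ∀ (r : R) (m : M), P r • q m = q (P r • m) + q (r • q m) + lam • q (r • m))
    (f : X → M)
    (hf : ∀ (x : X) (r : R), q (r • f x) = P r • f x) :
    ∃! φ : (X →₀ R) →ₗ[R] M,
      (∀ v : X →₀ R, φ (Finsupp.mapRange.linearMap (α := X) P v) = q (φ v)) ∧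
      ∀ x : X, φ (Finsupp.single x (1 : R)) = f x := by
  refine ⟨Finsupp.linearCombination R f, ⟨?_, ?_⟩, ?_⟩
  · intro v
    induction v using Finsupp.induction_linear with
    | zero => simp
    | add a b ha hb => rw [map_add, map_add, ha, hb, map_add, map_add]
    | single x r =>
      rw [Finsupp.mapRange.linearMap_apply, Finsupp.mapRange_single,
        Finsupp.linearCombination_single, Finsupp.linearCombination_single, hf]
  · intro x
    simp
  · rintro φ ⟨-, hφ⟩
    refine Finsupp.lhom_ext' fun x => LinearMap.ext_ring ?_
    simp [hφ]
end

section
/- Let (R,P) be a Rota-Baxter k-algebra of weight λ such that R has no zero divisors and MC(R) = R, i.e. P(rs) = P(r)s for all r,s ∈ R. Then P is right R-linear and P(1_R)·(P(1_R) + λ·1_R) = 0; consequently either P(1_R) = 0 or P(1_R) = −λ·1_R. -/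
/-- Let `(R,P)` be a Rota-Baxter `k`-algebra of weight `λ` such that `R` has no
zero divisors and `MC(R) = R`, i.e. `P(rs) = P(r)s` for all `r,s ∈ R`.  Then `P` is right
`R`-linear and `P(1)·(P(1) + λ·1) = 0`; consequently `P(1) = 0` or `P(1) = -λ·1`. -/
theorem module_constants_all
    (k : Type*) [CommRing k] (lam : k)
    (R : Type*) [Ring R] [Algebra k R] [NoZeroDivisors R] (P : R →ₗ[k] R)
    (hP : ∀ r s : R, P r * P s = P (r * P s) + P (P r * s) + lam • P (r * s))
    (hMC : ∀ r s : R, P (r * s) = P r * s) :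
    (∀ r s : R, P (r * s) = P r * s) ∧
    P 1 * (P 1 + lam • (1 : R)) = 0 ∧
    (P 1 = 0 ∨ P 1 = -(lam • (1 : R))) := by
  have h1 : P (P 1) = P 1 * P 1 := by simpa using hMC 1 (P 1)
  have h2 := hP 1 1
  simp only [one_mul, mul_one, h1] at h2
  have h3 : P 1 * (P 1 + lam • (1 : R)) = 0 := by
    rw [mul_add, mul_smul_comm, mul_one]
    rw [add_assoc] at h2
    exact left_eq_add.mp h2
  refine ⟨hMC, h3, ?_⟩
  rcases mul_eq_zero.mp h3 with h | h
  · exact Or.inl h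
  · exact Or.inr (eq_neg_of_add_eq_zero_left h)
end

section
/- Let (R,P) and (S,α) be Rota-Baxter k-algebras of weight λ. Let (M, p_M^R, p_M^S) be an (R,P)-(S,α)-bimodule: M is an (R,S)-bimodule, (M, p_M^R) is a left (R,P)-module, (M, p_M^S) is a right (S,α)-module, and p_M^S(rm) = r·p_M^S(m), p_M^R(ms) = p_M^R(m)·s, p_M^S(p_M^R(m)) = p_M^R(p_M^S(m)) for all r ∈ R, s ∈ S, m ∈ M. Let (N, p_N) be a left (R,P)-module, and let Hom_{(R,P)}(M,N) be the set of left R-linear maps f : M → N with f ∘ p_M^R = p_N ∘ f, made into a left S-module by (s·f)(m) := f(ms). Then for every f ∈ Hom_{(R,P)}(M,N) the map q(f) := f ∘ p_M^S again lies in Hom_{(R,P)}(M,N), and (Hom_{(R,P)}(M,N), q) is a left (S,α)-module: α(s)·q(f) = q(α(s)·f) + q(s·q(f)) + λ·q(s·f) for all s ∈ S and f ∈ Hom_{(R,P)}(M,N). -/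
open MulOpposite

/-- Let `(R,P)` and `(S,α)` be Rota-Baxter `k`-algebras of weight `λ`, let
`(M, p_M^R, p_M^S)` be an `(R,P)`-`(S,α)`-bimodule (right `S`-actions written via `Sᵐᵒᵖ`) and let
`(N,p_N)` be a left `(R,P)`-module.  On the set of left `R`-linear maps `M →ₗ[R] N`, with the
left `S`-action `(s·f)(m) = f(ms)`, the operator `q(f) = f ∘ p_M^S` preserves the subset
`Hom_{(R,P)}(M,N) = {f | f ∘ p_M^R = p_N ∘ f}` and satisfies the left Rota-Baxter module
identity `α(s)·q(f) = q(α(s)·f) + q(s·q(f)) + λ·q(s·f)` on that subset. -/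
theorem hom_from_bimodule_is_left_rotaBaxter_module
    (k : Type*) [CommRing k] (lam : k)
    (R : Type*) [Ring R] [Algebra k R] (P : R →ₗ[k] R)
    (hP : ∀ r s : R, P r * P s = P (r * P s) + P (P r * s) + lam • P (r * s))
    (S : Type*) [Ring S] [Algebra k S] (α : S →ₗ[k] S)
    (hα : ∀ s s' : S, α s * α s' = α (s * α s') + α (α s * s') + lam • α (s * s'))
    (M : Type*) [AddCommGroup M] [Module k M] [Module R M] [Module Sᵐᵒᵖ M]
    [IsScalarTower k R M] [SMulCommClass R Sᵐᵒᵖ M]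
    (pMR pMS : M →ₗ[k] M)
    -- `(M, p_M^R)` is a left `(R,P)`-module:
    (hMR : ∀ (r : R) (m : M),
      P r • pMR m = pMR (P r • m) + pMR (r • pMR m) + lam • pMR (r • m))
    -- `(M, p_M^S)` is a right `(S,α)`-module:
    (hMS : ∀ (s : S) (m : M),
      pMS (op (α s) • m) = op (α s) • pMS m + pMS (op s • pMS m) + lam • (op s • pMS m))
    -- bimodule compatibilities:
    (hc1 : ∀ (r : R) (m : M), pMS (r • m) = r • pMS m)
    (hc2 : ∀ (s : S) (m : M), pMR (op s • m) = op s • pMR m)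
    (hc3 : ∀ m : M, pMS (pMR m) = pMR (pMS m))
    (N : Type*) [AddCommGroup N] [Module k N] [Module R N] [IsScalarTower k R N]
    [SMulCommClass R k N]
    (pN : N →ₗ[k] N)
    (hN : ∀ (r : R) (n : N), P r • pN n = pN (P r • n) + pN (r • pN n) + lam • pN (r • n)) :
    ∃ (smulH : S → (M →ₗ[R] N) → (M →ₗ[R] N)) (Q : (M →ₗ[R] N) → (M →ₗ[R] N)),
      -- the `S`-action `(s·f)(m) = f(ms)`:
      (∀ (s : S) (f : M →ₗ[R] N) (m : M), smulH s f m = f (op s • m)) ∧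
      -- `q(f) = f ∘ p_M^S`:
      (∀ (f : M →ₗ[R] N) (m : M), Q f m = f (pMS m)) ∧
      -- `Q` preserves `Hom_{(R,P)}(M,N)`:
      (∀ f : M →ₗ[R] N, (∀ m, f (pMR m) = pN (f m)) → ∀ m, Q f (pMR m) = pN (Q f m)) ∧
      -- the left Rota-Baxter `(S,α)`-module identity:
      (∀ (s : S) (f : M →ₗ[R] N), (∀ m, f (pMR m) = pN (f m)) →
        smulH (α s) (Q f) = Q (smulH (α s) f) + Q (smulH s (Q f)) + lam • Q (smulH s f)) := by
  refine ⟨fun s f =>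
      { toFun := fun m => f (op s • m)
        map_add' := fun x y => by rw [smul_add, map_add]
        map_smul' := fun r x => by
          rw [← smul_comm r (op s) x, map_smul, RingHom.id_apply] },
    fun f =>
      { toFun := fun m => f (pMS m)
        map_add' := fun x y => by rw [map_add, map_add]
        map_smul' := fun r x => by rw [hc1, map_smul, RingHom.id_apply] },
    fun _ _ _ => rfl, fun _ _ => rfl, ?_, ?_⟩
  · intro f hf m
    change f (pMS (pMR m)) = pN (f (pMS m))
    rw [hc3, hf]
  · intro s f _
    ext m
    change f (pMS (op (α s) • m)) =
      f (op (α s) • pMS m) + f (pMS (op s • pMS m)) + lam • f (op s • pMS m)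
    rw [hMS, map_add, map_add, LinearMap.map_smul_of_tower f lam]
end

section
/- Let (R,P) and (S,α) be Rota-Baxter k-algebras of weight λ. Let (M, p_M^S, p_M^R) be an (S,α)-(R,P)-bimodule: M is an (S,R)-bimodule, (M, p_M^S) is a left (S,α)-module, (M, p_M^R) is a right (R,P)-module, and p_M^R(sm) = s·p_M^R(m), p_M^S(mr) = p_M^S(m)·r, p_M^S(p_M^R(m)) = p_M^R(p_M^S(m)) for all s ∈ S, r ∈ R, m ∈ M. Let (N, p_N) be a left (R,P)-module, and let T = M ⊗_{(R,P)} N be the tensor product, namely the quotient of the free abelian group on M × N by the subgroup generated by the elements (m+m',n) − (m,n) − (m',n), (m,n+n') − (m,n) − (m,n'), (mr,n) − (m,rn), (p_M^R(m),n) − (m,p_N(n)), with canonical map ι : M × N → T. Then there exist a left S-module structure on T satisfying s·ι(m,n) = ι(sm, n) and an additive map q : T → T satisfying q(ι(m,n)) = ι(p_M^S(m), n), and with these structures (T, q) is a left (S,α)-module: α(s)·q(t) = q(α(s)·t) + q(s·q(t)) + λ·q(s·t) for all s ∈ S and t ∈ T. -/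
open MulOpposite

universe u

/-- The generating set of relations for the tensor product `M ⊗_{(R,P)} N` of a right
Rota-Baxter module `(M,p_M)` and a left Rota-Baxter module `(N,p_N)`, inside the free abelian
group on `M × N`. -/
def rbTensorGen (R : Type u) [Ring R] (M N : Type u)
    [AddCommGroup M] [Module Rᵐᵒᵖ M] [AddCommGroup N] [Module R N]
    (pM : M → M) (pN : N → N) : Set (FreeAbelianGroup (M × N)) :=
  {z | (∃ m m' n, z = FreeAbelianGroup.of (m + m', n) - FreeAbelianGroup.of (m, n)
          - FreeAbelianGroup.of (m', n)) ∨
       (∃ m n n', z = FreeAbelianGroup.of (m, n + n') - FreeAbelianGroup.of (m, n)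
          - FreeAbelianGroup.of (m, n')) ∨
       (∃ (m : M) (r : R) (n : N), z = FreeAbelianGroup.of (op r • m, n)
          - FreeAbelianGroup.of (m, r • n)) ∨
       (∃ m n, z = FreeAbelianGroup.of (pM m, n) - FreeAbelianGroup.of (m, pN n))}

/-- The subgroup generated by the tensor-product relations. -/
def rbTensorRel (R : Type u) [Ring R] (M N : Type u)
    [AddCommGroup M] [Module Rᵐᵒᵖ M] [AddCommGroup N] [Module R N]
    (pM : M → M) (pN : N → N) : AddSubgroup (FreeAbelianGroup (M × N)) :=
  AddSubgroup.closure (rbTensorGen R M N pM pN)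

/-- The tensor product `M ⊗_{(R,P)} N` as the quotient of the free abelian group on `M × N` by
the subgroup of relations. -/
abbrev rbTensor (R : Type u) [Ring R] (M N : Type u)
    [AddCommGroup M] [Module Rᵐᵒᵖ M] [AddCommGroup N] [Module R N]
    (pM : M → M) (pN : N → N) : Type u :=
  FreeAbelianGroup (M × N) ⧸ rbTensorRel R M N pM pN

/-- The canonical map `ι : M × N → M ⊗_{(R,P)} N`. -/
def rbTensorMk (R : Type u) [Ring R] (M N : Type u)
    [AddCommGroup M] [Module Rᵐᵒᵖ M] [AddCommGroup N] [Module R N]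
    (pM : M → M) (pN : N → N) : M × N → rbTensor R M N pM pN :=
  fun x => QuotientAddGroup.mk (FreeAbelianGroup.of x)

/-- An additive endomorphism of `M` commuting with the right action and `pM` induces an additive
endomorphism of the tensor product. -/
theorem rbTensor_exists_map (R : Type u) [Ring R] (M N : Type u)
    [AddCommGroup M] [Module Rᵐᵒᵖ M] [AddCommGroup N] [Module R N]
    (pM : M → M) (pN : N → N) (f : M →+ M)
    (hf1 : ∀ (r : R) (m : M), f (op r • m) = op r • f m)
    (hf2 : ∀ m : M, f (pM m) = pM (f m)) :
    ∃ F : rbTensor R M N pM pN →+ rbTensor R M N pM pN,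
      ∀ m n, F (rbTensorMk R M N pM pN (m, n)) = rbTensorMk R M N pM pN (f m, n) := by
  refine ⟨QuotientAddGroup.map _ _
    (FreeAbelianGroup.lift fun x : M × N => FreeAbelianGroup.of (f x.1, x.2)) ?_, ?_⟩
  · unfold rbTensorRel
    rw [AddSubgroup.closure_le]
    intro z hz
    apply AddSubgroup.subset_closure
    rcases hz with ⟨m, m', n, rfl⟩ | ⟨m, n, n', rfl⟩ | ⟨m, r, n, rfl⟩ | ⟨m, n, rfl⟩
    · exact Or.inl ⟨f m, f m', n, by simp⟩
    · exact Or.inr (Or.inl ⟨f m, n, n', by simp⟩)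
    · exact Or.inr (Or.inr (Or.inl ⟨f m, r, n, by simp [hf1]⟩))
    · exact Or.inr (Or.inr (Or.inr ⟨f m, n, by simp [hf2]⟩))
  · intro m n
    simp [rbTensorMk]

theorem rbTensorMk_add_left (R : Type u) [Ring R] (M N : Type u)
    [AddCommGroup M] [Module Rᵐᵒᵖ M] [AddCommGroup N] [Module R N]
    (pM : M → M) (pN : N → N) (m m' : M) (n : N) :
    rbTensorMk R M N pM pN (m + m', n)
      = rbTensorMk R M N pM pN (m, n) + rbTensorMk R M N pM pN (m', n) := by
  unfold rbTensorMk
  rw [← QuotientAddGroup.mk_add, eq_comm, QuotientAddGroup.eq]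
  apply AddSubgroup.subset_closure
  exact Or.inl ⟨m, m', n, by abel⟩

theorem rbTensor_hom_ext (R : Type u) [Ring R] (M N : Type u)
    [AddCommGroup M] [Module Rᵐᵒᵖ M] [AddCommGroup N] [Module R N]
    (pM : M → M) (pN : N → N) (F G : rbTensor R M N pM pN →+ rbTensor R M N pM pN)
    (h : ∀ m n, F (rbTensorMk R M N pM pN (m, n)) = G (rbTensorMk R M N pM pN (m, n)))
    (x : rbTensor R M N pM pN) : F x = G x := by
  have : F = G := by
    apply QuotientAddGroup.addMonoidHom_ext
    apply FreeAbelianGroup.lift_ext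
    rintro ⟨m, n⟩
    exact h m n
  rw [this]

/-- **extension of scalars.** Let `(R,P)` and `(S,α)` be Rota-Baxter `k`-algebras
of weight `λ`, `(M, p_M^S, p_M^R)` an `(S,α)`-`(R,P)`-bimodule and `(N,p_N)` a left
`(R,P)`-module.  Then on `T = M ⊗_{(R,P)} N` there are a left `S`-module structure with
`s·ι(m,n) = ι(sm,n)` and an additive map `q` with `q(ι(m,n)) = ι(p_M^S(m), n)`, making `(T,q)` a
left `(S,α)`-module:  `α(s)·q(t) = q(α(s)·t) + q(s·q(t)) + λ·q(s·t)` (where `λ` acts through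
`algebraMap k S`). -/
theorem rbTensor_extension_of_scalars
    (k : Type u) [CommRing k] (lam : k)
    (R : Type u) [Ring R] [Algebra k R] (P : R →ₗ[k] R)
    (hP : ∀ r s : R, P r * P s = P (r * P s) + P (P r * s) + lam • P (r * s))
    (S : Type u) [Ring S] [Algebra k S] (α : S →ₗ[k] S)
    (hα : ∀ s s' : S, α s * α s' = α (s * α s') + α (α s * s') + lam • α (s * s'))
    (M : Type u) [AddCommGroup M] [Module k M] [Module S M] [Module Rᵐᵒᵖ M]
    [IsScalarTower k S M] [SMulCommClass S Rᵐᵒᵖ M]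
    (pMS pMR : M →ₗ[k] M)
    -- `(M, p_M^S)` is a left `(S,α)`-module:
    (hMS : ∀ (s : S) (m : M),
      α s • pMS m = pMS (α s • m) + pMS (s • pMS m) + lam • pMS (s • m))
    -- `(M, p_M^R)` is a right `(R,P)`-module:
    (hMR : ∀ (r : R) (m : M),
      pMR (op (P r) • m) = op (P r) • pMR m + pMR (op r • pMR m) + lam • (op r • pMR m))
    -- bimodule compatibilities:
    (hc1 : ∀ (s : S) (m : M), pMR (s • m) = s • pMR m)
    (hc2 : ∀ (r : R) (m : M), pMS (op r • m) = op r • pMS m)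
    (hc3 : ∀ m : M, pMS (pMR m) = pMR (pMS m))
    (N : Type u) [AddCommGroup N] [Module k N] [Module R N] [IsScalarTower k R N]
    (pN : N →ₗ[k] N)
    (hpN : ∀ (r : R) (n : N), P r • pN n = pN (P r • n) + pN (r • pN n) + lam • pN (r • n)) :
    ∃ (smul : S → rbTensor R M N pMR pN → rbTensor R M N pMR pN)
      (q : rbTensor R M N pMR pN → rbTensor R M N pMR pN),
      -- `smul` is a left `S`-module structure on `T`:
      (∀ (s : S) (x y : rbTensor R M N pMR pN), smul s (x + y) = smul s x + smul s y) ∧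
      (∀ (s s' : S) (x : rbTensor R M N pMR pN), smul (s + s') x = smul s x + smul s' x) ∧
      (∀ (s s' : S) (x : rbTensor R M N pMR pN), smul (s * s') x = smul s (smul s' x)) ∧
      (∀ x : rbTensor R M N pMR pN, smul 1 x = x) ∧
      -- `s · ι(m,n) = ι(sm, n)`:
      (∀ (s : S) (m : M) (n : N),
        smul s (rbTensorMk R M N pMR pN (m, n)) = rbTensorMk R M N pMR pN (s • m, n)) ∧
      -- `q` is additive and `q(ι(m,n)) = ι(p_M^S(m), n)`:
      (∀ x y : rbTensor R M N pMR pN, q (x + y) = q x + q y) ∧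
      (∀ (m : M) (n : N),
        q (rbTensorMk R M N pMR pN (m, n)) = rbTensorMk R M N pMR pN (pMS m, n)) ∧
      -- `(T, q)` is a left `(S,α)`-module:
      (∀ (s : S) (t : rbTensor R M N pMR pN),
        smul (α s) (q t) = q (smul (α s) t) + q (smul s (q t))
          + smul (algebraMap k S lam) (q (smul s t))) := by
  have hS := fun s : S => rbTensor_exists_map R M N pMR pN
    (DistribSMul.toAddMonoidHom M s) (fun r m => smul_comm s (op r) m) (fun m => (hc1 s m).symm)
  choose A hA using hS
  obtain ⟨q, hq⟩ := rbTensor_exists_map R M N pMR pN pMS.toAddMonoidHom hc2 hc3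
  simp only [DistribSMul.toAddMonoidHom_apply, LinearMap.toAddMonoidHom_coe] at hA hq
  refine ⟨fun s => A s, q, fun s => map_add _, ?_, ?_, ?_, hA, map_add q, hq, ?_⟩
  · intro s s' x
    exact rbTensor_hom_ext R M N pMR pN (A (s + s')) (A s + A s')
      (fun m n => by simp [hA, add_smul, rbTensorMk_add_left]) x
  · intro s s' x
    exact rbTensor_hom_ext R M N pMR pN (A (s * s')) ((A s).comp (A s'))
      (fun m n => by simp [hA, mul_smul]) x
  · intro x
    exact rbTensor_hom_ext R M N pMR pN (A 1) (AddMonoidHom.id _)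
      (fun m n => by simp [hA]) x
  · intro s t
    exact rbTensor_hom_ext R M N pMR pN ((A (α s)).comp q)
      (q.comp (A (α s)) + q.comp ((A s).comp q)
        + (A (algebraMap k S lam)).comp (q.comp (A s)))
      (fun m n => by simp [hA, hq, hMS, rbTensorMk_add_left]) t
end

section
/- Let (R,P) be a Rota-Baxter k-algebra of weight λ. Then every left (R,P)-module can be embedded into an injective left (R,P)-module: for every left (R,P)-module (V,p) there exist a left (R,P)-module (E,p_E) and an injective left (R,P)-module homomorphism (V,p) → (E,p_E), where (E,p_E) is injective in the sense that for every injective left (R,P)-module homomorphism f : (N,p_N) → (M,p_M) and every left (R,P)-module homomorphism g : (N,p_N) → (E,p_E), there exists a left (R,P)-module homomorphism ḡ : (M,p_M) → (E,p_E) with ḡ ∘ f = g. -/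
universe u

namespace RBHelper

/-- Relations defining the ring of Rota-Baxter operators. -/
inductive Rel {k R : Type u} [CommRing k] [Ring R] [Algebra k R] (lam : k) (P : R →ₗ[k] R) :
    FreeAlgebra k (Option R) → FreeAlgebra k (Option R) → Prop
  | add (r s : R) : Rel lam P (FreeAlgebra.ι k (some (r + s)))
      (FreeAlgebra.ι k (some r) + FreeAlgebra.ι k (some s))
  | mul (r s : R) : Rel lam P (FreeAlgebra.ι k (some (r * s)))
      (FreeAlgebra.ι k (some r) * FreeAlgebra.ι k (some s))
  | alg (c : k) : Rel lam P (FreeAlgebra.ι k (some (algebraMap k R c))) (algebraMap k _ c)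
  | rb (r : R) : Rel lam P (FreeAlgebra.ι k (some (P r)) * FreeAlgebra.ι k none)
      (FreeAlgebra.ι k none * FreeAlgebra.ι k (some (P r))
        + FreeAlgebra.ι k none * (FreeAlgebra.ι k (some r) * FreeAlgebra.ι k none)
        + lam • (FreeAlgebra.ι k none * FreeAlgebra.ι k (some r)))

theorem exists_ring (k R : Type u) [CommRing k] [Ring R] [Algebra k R] (lam : k)
    (P : R →ₗ[k] R) :
    ∃ (A : Type u) (_ : Ring A) (_ : Algebra k A) (i : R →ₐ[k] A) (Q : A),
      (∀ r, i (P r) * Q = Q * i (P r) + Q * (i r * Q) + lam • (Q * i r)) ∧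
      (∀ (M M' : Type u) [AddCommGroup M] [AddCommGroup M'] [Module A M] [Module A M']
        (F : M →+ M'), (∀ r m, F (i r • m) = i r • F m) → (∀ m, F (Q • m) = Q • F m) →
        ∀ (a : A) m, F (a • m) = a • F m) ∧
      (∀ (M : Type u) [AddCommGroup M] [Module k M] [Module R M] [IsScalarTower k R M]
        (p : M →ₗ[k] M),
        (∀ (r : R) (v : M), P r • p v = p (P r • v) + p (r • p v) + lam • p (r • v)) →
        ∃ (_ : Module A M), (∀ (r : R) (m : M), i r • m = r • m) ∧ ∀ m : M, Q • m = p m) := by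
  let A := RingQuot (Rel lam P)
  let π : FreeAlgebra k (Option R) →ₐ[k] A := RingQuot.mkAlgHom k (Rel lam P)
  have hπ : ∀ {x y}, Rel lam P x y → π x = π y := fun h => RingQuot.mkAlgHom_rel k h
  have halg : ∀ c : k, π (FreeAlgebra.ι k (some (algebraMap k R c))) = algebraMap k A c := by
    intro c
    rw [hπ (Rel.alg c), AlgHom.commutes]
  have hadd : ∀ r s : R, π (FreeAlgebra.ι k (some (r + s))) =
      π (FreeAlgebra.ι k (some r)) + π (FreeAlgebra.ι k (some s)) := by
    intro r s
    rw [hπ (Rel.add r s), map_add]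
  have hmul : ∀ r s : R, π (FreeAlgebra.ι k (some (r * s))) =
      π (FreeAlgebra.ι k (some r)) * π (FreeAlgebra.ι k (some s)) := by
    intro r s
    rw [hπ (Rel.mul r s), map_mul]
  let i : R →ₐ[k] A :=
    { toFun := fun r => π (FreeAlgebra.ι k (some r))
      map_one' := by simpa using halg 1
      map_zero' := by simpa using halg 0
      map_add' := hadd
      map_mul' := hmul
      commutes' := halg }
  have hi : ∀ r, i r = π (FreeAlgebra.ι k (some r)) := fun _ => rfl
  refine ⟨A, inferInstance, inferInstance, i, π (FreeAlgebra.ι k none), ?_, ?_, ?_⟩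
  · intro r
    have := hπ (Rel.rb (lam := lam) (P := P) r)
    simpa only [hi, map_mul, map_add, map_smul] using this
  · intro M M' _ _ _ _ F hF hQ a
    obtain ⟨x, rfl⟩ := RingQuot.mkAlgHom_surjective k (Rel lam P) a
    change ∀ m, F (π x • m) = π x • F m
    induction x using FreeAlgebra.induction with
    | grade0 c =>
      intro m
      rw [AlgHom.commutes, ← halg]
      exact hF _ m
    | grade1 y =>
      cases y with
      | none => exact hQ
      | some r => exact hF r
    | mul x y hx hy =>
      intro m
      rw [map_mul, mul_smul, mul_smul, hx, hy]
    | add x y hx hy =>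
      intro m
      rw [map_add, add_smul, add_smul, map_add, hx, hy]
  · intro M _ _ _ _ p hp
    let φ₀ : FreeAlgebra k (Option R) →ₐ[k] Module.End k M :=
      FreeAlgebra.lift k (fun o => o.elim p (fun r => Algebra.lsmul k k M r))
    have h0 : φ₀ (FreeAlgebra.ι k none) = p := by simp [φ₀]
    have h1 : ∀ r, φ₀ (FreeAlgebra.ι k (some r)) = Algebra.lsmul k k M r := by
      intro r; simp [φ₀]
    have hrel : ∀ ⦃x y⦄, Rel lam P x y → φ₀ x = φ₀ y := by
      intro x y h
      cases h with
      | add r s => simp only [map_add, h1]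
      | mul r s => simp only [map_mul, h1]
      | alg c => rw [h1, AlgHom.commutes, AlgHom.commutes]
      | rb r =>
        simp only [map_add, map_mul, map_smul, h1, h0]
        ext m
        simpa using hp r m
    let φ : A →ₐ[k] Module.End k M := RingQuot.liftAlgHom k ⟨φ₀, hrel⟩
    have hφ : ∀ x, φ (π x) = φ₀ x := fun x =>
      RingQuot.liftAlgHom_mkAlgHom_apply k φ₀ hrel x
    refine ⟨Module.compHom M φ.toRingHom, ?_, ?_⟩
    · intro r m
      change φ (π _) m = _
      rw [hφ, h1]; rfl
    · intro m
      change φ (π _) m = _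
      rw [hφ, h0]

theorem exists_injective (A : Type u) [Ring A] (V : Type u) [AddCommGroup V] [Module A V] :
    ∃ (E : Type u) (_ : AddCommGroup E) (_ : Module A E) (e : V →ₗ[A] E),
      Module.Injective A E ∧ Function.Injective e := by
  obtain ⟨⟨J, hJ, f, hf⟩⟩ := CategoryTheory.EnoughInjectives.presentation (ModuleCat.of A V)
  exact ⟨J, inferInstance, inferInstance, f.hom,
    (Module.injective_iff_injective_object A J).mpr hJ, (ModuleCat.mono_iff_injective f).mp hf⟩

end RBHelper

/-- Let `(R,P)` be a Rota-Baxter `k`-algebra of weight `λ`.  Every left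
`(R,P)`-module `(V,p)` can be embedded into an injective left `(R,P)`-module: there exist a left
`(R,P)`-module `(E,p_E)` which is injective (every left `(R,P)`-module homomorphism into `E`
extends along every injective left `(R,P)`-module homomorphism) and an injective left
`(R,P)`-module homomorphism `(V,p) → (E,p_E)`. -/
theorem rotaBaxter_module_embeds_into_injective
    (k R : Type u) [CommRing k] [Ring R] [Algebra k R] (lam : k)
    (P : R →ₗ[k] R)
    (hP : ∀ r s : R, P r * P s = P (r * P s) + P (P r * s) + lam • P (r * s))
    (V : Type u) [AddCommGroup V] [Module k V] [Module R V] [IsScalarTower k R V]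
    (p : V →ₗ[k] V)
    (hp : ∀ (r : R) (v : V), P r • p v = p (P r • v) + p (r • p v) + lam • p (r • v)) :
    ∃ (E : Type u) (_ : AddCommGroup E) (_ : Module k E) (_ : Module R E)
      (_ : IsScalarTower k R E) (pE : E →ₗ[k] E),
      -- `(E, p_E)` is a left `(R,P)`-module:
      (∀ (r : R) (e : E), P r • pE e = pE (P r • e) + pE (r • pE e) + lam • pE (r • e)) ∧
      -- `(E, p_E)` is injective:
      (∀ (N : Type u) (_ : AddCommGroup N) (_ : Module k N) (_ : Module R N)
        (_ : IsScalarTower k R N) (pN : N →ₗ[k] N),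
        (∀ (r : R) (n : N), P r • pN n = pN (P r • n) + pN (r • pN n) + lam • pN (r • n)) →
        ∀ (M : Type u) (_ : AddCommGroup M) (_ : Module k M) (_ : Module R M)
          (_ : IsScalarTower k R M) (pM : M →ₗ[k] M),
          (∀ (r : R) (m : M), P r • pM m = pM (P r • m) + pM (r • pM m) + lam • pM (r • m)) →
          ∀ (f : N →ₗ[R] M), Function.Injective f → (∀ n : N, f (pN n) = pM (f n)) →
            ∀ (g : N →ₗ[R] E), (∀ n : N, g (pN n) = pE (g n)) →
              ∃ gbar : M →ₗ[R] E, (∀ m : M, gbar (pM m) = pE (gbar m)) ∧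
                ∀ n : N, gbar (f n) = g n) ∧
      -- `(V,p)` embeds into `(E,p_E)`:
      ∃ e : V →ₗ[R] E, Function.Injective e ∧ ∀ v : V, e (p v) = pE (e v) := by

  obtain ⟨A, _, _, i, Q, hQ, hlin, hmod⟩ := RBHelper.exists_ring k R lam P
  obtain ⟨_, hV1, hV2⟩ := hmod V p hp
  obtain ⟨E, _, _, e, hE, he⟩ := RBHelper.exists_injective A V
  letI mk : Module k E := Module.compHom E (algebraMap k A)
  letI mR : Module R E := Module.compHom E i.toRingHom
  have hk : ∀ (c : k) (x : E), c • x = algebraMap k A c • x := fun _ _ => rfl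
  have hR : ∀ (r : R) (x : E), r • x = i r • x := fun _ _ => rfl
  have tow : IsScalarTower k R E := ⟨fun c r x => by
    rw [hR, hR, hk, map_smul, Algebra.smul_def, mul_smul]⟩
  let pE : E →ₗ[k] E :=
    { toFun := fun x => Q • x
      map_add' := fun x y => smul_add _ _ _
      map_smul' := fun c x => by
        simp only [hk, RingHom.id_apply, ← mul_smul, Algebra.commutes] }
  have hpE : ∀ x, pE x = Q • x := fun _ => rfl
  refine ⟨E, inferInstance, mk, mR, tow, pE, ?_, ?_, ?_⟩
  · intro r x
    simp only [hpE, hR, hk, ← mul_smul, ← add_smul]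
    rw [hQ, Algebra.smul_def]
  · intro N _ _ _ _ pN hN M _ _ _ _ pM hM f hf hfp g hgp
    obtain ⟨_, hN1, hN2⟩ := hmod N pN hN
    obtain ⟨_, hM1, hM2⟩ := hmod M pM hM
    let f' : N →ₗ[A] M :=
      { toFun := f
        map_add' := map_add f
        map_smul' := hlin N M f.toAddMonoidHom
          (fun r m => by simp [hN1, hM1]) (fun m => by simp [hN2, hM2, hfp]) }
    let g' : N →ₗ[A] E :=
      { toFun := g
        map_add' := map_add g
        map_smul' := hlin N E g.toAddMonoidHom
          (fun r m => by simp [hN1, hR]) (fun m => by simp [hN2, hgp, hpE]) }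
    obtain ⟨h, hh⟩ := hE.out f' hf g'
    refine ⟨{ toFun := h, map_add' := map_add h, map_smul' := fun r m => ?_ }, fun m => ?_, hh⟩
    · rw [← hM1, map_smul]; rfl
    · change h (pM m) = Q • h m
      rw [← hM2, map_smul]
  · refine ⟨{ toFun := e, map_add' := map_add e, map_smul' := fun r m => ?_ }, he, fun m => ?_⟩
    · rw [← hV1, map_smul]; rfl
    · change e (p m) = Q • e m
      rw [← hV2, map_smul]
end

section
/- Let (R,P) be a Rota-Baxter k-algebra of weight λ and let (M,p) be a projective left (R,P)-module (for every surjective left (R,P)-module homomorphism f : (N,p_N) → (L,p_L) and every left (R,P)-module homomorphism g : (M,p) → (L,p_L), there exists a left (R,P)-module homomorphism ḡ : (M,p) → (N,p_N) with f ∘ ḡ = g). Then (M,p) is a direct summand of a free left (R,P)-module: there exist a set X, a free left (R,P)-module (F,p') on X (a left (R,P)-module with a map j : X → F satisfying the universal property that every map from X into a left (R,P)-module extends uniquely to a left (R,P)-module homomorphism from F), and left (R,P)-module homomorphisms β : (M,p) → (F,p') and f : (F,p') → (M,p) with f ∘ β = id_M. -/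
universe u

namespace RBAux

section
variable {k R : Type u} [CommRing k] [Ring R] [Algebra k R]

/-- Relations of the ring of Rota-Baxter operators: generators `some r` for `r : R`, and `none`
for the operator. -/
inductive Rel (lam : k) (P : R →ₗ[k] R) :
    FreeAlgebra k (Option R) → FreeAlgebra k (Option R) → Prop
  | add (r s : R) : Rel lam P (FreeAlgebra.ι k (some (r + s)))
      (FreeAlgebra.ι k (some r) + FreeAlgebra.ι k (some s))
  | mul (r s : R) : Rel lam P (FreeAlgebra.ι k (some (r * s)))
      (FreeAlgebra.ι k (some r) * FreeAlgebra.ι k (some s))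
  | scal (c : k) : Rel lam P (FreeAlgebra.ι k (some (algebraMap k R c)))
      (algebraMap k (FreeAlgebra k (Option R)) c)
  | rb (r : R) : Rel lam P (FreeAlgebra.ι k (some (P r)) * FreeAlgebra.ι k none)
      (FreeAlgebra.ι k none * FreeAlgebra.ι k (some (P r)) +
        FreeAlgebra.ι k none * FreeAlgebra.ι k (some r) * FreeAlgebra.ι k none +
        lam • (FreeAlgebra.ι k none * FreeAlgebra.ι k (some r)))

/-- The ring of Rota-Baxter operators. -/
abbrev Op (lam : k) (P : R →ₗ[k] R) : Type u := RingQuot (Rel lam P)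

/-- The inclusion of `R`. -/
noncomputable def inc (lam : k) (P : R →ₗ[k] R) : R →ₐ[k] Op lam P :=
  AlgHom.ofLinearMap
    { toFun := fun r => RingQuot.mkAlgHom k (Rel lam P) (FreeAlgebra.ι k (some r))
      map_add' := fun r s => by
        rw [RingQuot.mkAlgHom_rel k (Rel.add (lam := lam) (P := P) r s), map_add]
      map_smul' := fun c r => by
        rw [Algebra.smul_def, RingQuot.mkAlgHom_rel k (Rel.mul (lam := lam) (P := P) _ r), map_mul,
          RingQuot.mkAlgHom_rel k (Rel.scal (lam := lam) (P := P) c), AlgHom.commutes,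
          RingHom.id_apply, Algebra.smul_def] }
    (by
      have h := RingQuot.mkAlgHom_rel k (Rel.scal (lam := lam) (P := P) 1)
      simpa using h)
    (fun r s => by
      have h := RingQuot.mkAlgHom_rel k (Rel.mul (lam := lam) (P := P) r s)
      simpa using h)

/-- The operator. -/
noncomputable def Q (lam : k) (P : R →ₗ[k] R) : Op lam P :=
  RingQuot.mkAlgHom k (Rel lam P) (FreeAlgebra.ι k none)

theorem inc_apply (lam : k) (P : R →ₗ[k] R) (r : R) :
    inc lam P r = RingQuot.mkAlgHom k (Rel lam P) (FreeAlgebra.ι k (some r)) := rfl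

theorem inc_Q (lam : k) (P : R →ₗ[k] R) (r : R) :
    inc lam P (P r) * Q lam P = Q lam P * inc lam P (P r) + Q lam P * inc lam P r * Q lam P +
      lam • (Q lam P * inc lam P r) := by
  have h := RingQuot.mkAlgHom_rel k (Rel.rb (lam := lam) (P := P) r)
  simp only [map_add, map_mul, map_smul] at h
  exact h

theorem Op_induction (lam : k) (P : R →ₗ[k] R) (C : Op lam P → Prop)
    (hR : ∀ r, C (inc lam P r)) (hQ : C (Q lam P)) (hadd : ∀ a b, C a → C b → C (a + b))
    (hmul : ∀ a b, C a → C b → C (a * b)) (a : Op lam P) : C a := by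
  obtain ⟨b, rfl⟩ := RingQuot.mkAlgHom_surjective k (Rel lam P) a
  induction b using FreeAlgebra.induction with
  | grade0 c =>
    have h := hR (algebraMap k R c)
    rwa [AlgHom.commutes] at h ⊢
  | grade1 x =>
    cases x with
    | none => exact hQ
    | some r => exact hR r
  | mul a b ha hb => rw [map_mul]; exact hmul _ _ ha hb
  | add a b ha hb => rw [map_add]; exact hadd _ _ ha hb

/-- The action on a module. -/
theorem exists_act (lam : k) (P : R →ₗ[k] R)
    (L : Type u) [AddCommGroup L] [Module k L] [Module R L] [IsScalarTower k R L]
    (pL : L →ₗ[k] L)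
    (hL : ∀ (r : R) (l : L), P r • pL l = pL (P r • l) + pL (r • pL l) + lam • pL (r • l)) :
    ∃ ψ : Op lam P →ₐ[k] Module.End k L, (∀ r l, ψ (inc lam P r) l = r • l) ∧
      ∀ l, ψ (Q lam P) l = pL l := by
  let g : Option R → Module.End k L := fun x => x.elim pL (fun r => Algebra.lsmul k k L r)
  refine ⟨RingQuot.liftAlgHom k ⟨FreeAlgebra.lift k g, ?_⟩, ?_, ?_⟩
  · intro x y h
    cases h with
    | add r s => ext l; simp [g, add_smul]
    | mul r s => ext l; simp [g, mul_smul]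
    | scal c => ext l; simp [g]
    | rb r => ext l; simpa [g] using hL r l
  · intro r l
    simp [inc_apply, g]
  · intro l
    simp [Q, g]

end
end RBAux

open RBAux in
/-- Let `(R,P)` be a Rota-Baxter `k`-algebra of weight `λ` and let `(M,p)` be a
projective left `(R,P)`-module.  Then `(M,p)` is a direct summand of a free left `(R,P)`-module:
there exist a set `X`, a free left `(R,P)`-module `(F,p')` on `X`, and left `(R,P)`-module
homomorphisms `β : (M,p) → (F,p')` and `f : (F,p') → (M,p)` with `f ∘ β = id`. -/
theorem projective_rotaBaxter_module_summand_of_free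
    (k R : Type u) [CommRing k] [Ring R] [Algebra k R] (lam : k)
    (P : R →ₗ[k] R)
    (hP : ∀ r s : R, P r * P s = P (r * P s) + P (P r * s) + lam • P (r * s))
    (M : Type u) [AddCommGroup M] [Module k M] [Module R M] [IsScalarTower k R M]
    (p : M →ₗ[k] M)
    (hp : ∀ (r : R) (m : M), P r • p m = p (P r • m) + p (r • p m) + lam • p (r • m))
    -- `(M,p)` is projective:
    (hproj : ∀ (N : Type u) (_ : AddCommGroup N) (_ : Module k N) (_ : Module R N)
      (_ : IsScalarTower k R N) (pN : N →ₗ[k] N),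
      (∀ (r : R) (n : N), P r • pN n = pN (P r • n) + pN (r • pN n) + lam • pN (r • n)) →
      ∀ (L : Type u) (_ : AddCommGroup L) (_ : Module k L) (_ : Module R L)
        (_ : IsScalarTower k R L) (pL : L →ₗ[k] L),
        (∀ (r : R) (l : L), P r • pL l = pL (P r • l) + pL (r • pL l) + lam • pL (r • l)) →
        ∀ (f : N →ₗ[R] L), (∀ n : N, f (pN n) = pL (f n)) → Function.Surjective f →
          ∀ (g : M →ₗ[R] L), (∀ m : M, g (p m) = pL (g m)) →
            ∃ gbar : M →ₗ[R] N, (∀ m : M, gbar (p m) = pN (gbar m)) ∧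
              ∀ m : M, f (gbar m) = g m) :
    ∃ (X : Type u) (F : Type u) (_ : AddCommGroup F) (_ : Module k F) (_ : Module R F)
      (_ : IsScalarTower k R F) (p' : F →ₗ[k] F) (j : X → F),
      -- `(F,p')` is a left `(R,P)`-module:
      (∀ (r : R) (v : F), P r • p' v = p' (P r • v) + p' (r • p' v) + lam • p' (r • v)) ∧
      -- `(F,p')` with `j` is free on `X`:
      (∀ (L : Type u) (_ : AddCommGroup L) (_ : Module k L) (_ : Module R L)
        (_ : IsScalarTower k R L) (pL : L →ₗ[k] L),
        (∀ (r : R) (l : L), P r • pL l = pL (P r • l) + pL (r • pL l) + lam • pL (r • l)) →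
        ∀ f : X → L,
          ∃! φ : F →ₗ[R] L, (∀ v : F, φ (p' v) = pL (φ v)) ∧ ∀ x : X, φ (j x) = f x) ∧
      -- `(M,p)` is a direct summand of `(F,p')`:
      ∃ (β : M →ₗ[R] F) (f : F →ₗ[R] M),
        (∀ m : M, β (p m) = p' (β m)) ∧ (∀ v : F, f (p' v) = p (f v)) ∧
        ∀ m : M, f (β m) = m := by
  classical
  letI iR : Module R (M →₀ Op lam P) := Module.compHom _ (inc lam P).toRingHom
  have smul_def : ∀ (r : R) (v : M →₀ Op lam P), r • v = inc lam P r • v := fun _ _ => rfl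
  haveI iT : IsScalarTower k R (M →₀ Op lam P) := ⟨fun c r v => by
    rw [smul_def, smul_def, map_smul, smul_assoc]⟩
  let p' : (M →₀ Op lam P) →ₗ[k] (M →₀ Op lam P) :=
    { toFun := fun v => Q lam P • v
      map_add' := fun v w => smul_add _ _ _
      map_smul' := fun c v => smul_comm _ _ _ }
  have p'_def : ∀ v, p' v = Q lam P • v := fun _ => rfl
  let j : M → (M →₀ Op lam P) := fun x => Finsupp.single x 1
  have hF : ∀ (r : R) (v : M →₀ Op lam P),
      P r • p' v = p' (P r • v) + p' (r • p' v) + lam • p' (r • v) := by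
    intro r v
    simp only [p'_def, smul_def, smul_smul, ← smul_assoc, ← add_smul]
    rw [inc_Q]
    simp only [mul_assoc]
    try rfl
  have hfree : ∀ (L : Type u) (_ : AddCommGroup L) (_ : Module k L) (_ : Module R L)
        (_ : IsScalarTower k R L) (pL : L →ₗ[k] L),
        (∀ (r : R) (l : L), P r • pL l = pL (P r • l) + pL (r • pL l) + lam • pL (r • l)) →
        ∀ f : M → L,
          ∃! φ : (M →₀ Op lam P) →ₗ[R] L,
            (∀ v, φ (p' v) = pL (φ v)) ∧ ∀ x : M, φ (j x) = f x := by
    intro L _ _ _ _ pL hL f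
    obtain ⟨ψ, hψR, hψQ⟩ := exists_act lam P L pL hL
    letI : Module (Op lam P) L := Module.compHom L ψ.toRingHom
    have sL : ∀ (a : Op lam P) (l : L), a • l = ψ a l := fun _ _ => rfl
    let φ₀ : (M →₀ Op lam P) →ₗ[Op lam P] L := Finsupp.linearCombination (Op lam P) f
    refine ⟨{ toFun := φ₀, map_add' := map_add φ₀, map_smul' := fun r v => ?_ }, ⟨?_, ?_⟩, ?_⟩
    · rw [smul_def, map_smul, sL, hψR, RingHom.id_apply]
    · intro v
      change φ₀ (p' v) = pL (φ₀ v)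
      rw [p'_def, map_smul, sL, hψQ]
    · intro x
      change φ₀ (Finsupp.single x 1) = f x
      simp [φ₀]
    · rintro φ ⟨h1, h2⟩
      have hlin : ∀ (a : Op lam P) (v : M →₀ Op lam P), φ (a • v) = a • φ v := by
        intro a
        refine Op_induction lam P (fun a => ∀ v : M →₀ Op lam P, φ (a • v) = a • φ v)
          ?_ ?_ ?_ ?_ a
        · intro r v
          rw [← smul_def, map_smul, sL, hψR]
        · intro v
          rw [← p'_def, h1, sL, hψQ]
        · intro a b ha hb v
          rw [add_smul, map_add, ha, hb, add_smul]
        · intro a b ha hb v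
          rw [mul_smul, ha, hb, mul_smul]
      let φ₁ : (M →₀ Op lam P) →ₗ[Op lam P] L :=
        { toFun := φ, map_add' := map_add φ, map_smul' := hlin }
      have h : φ₁ = φ₀ := by
        refine Finsupp.lhom_ext' fun x => LinearMap.ext_ring ?_
        change φ (j x) = φ₀ (Finsupp.single x 1)
        rw [h2]
        simp [φ₀]
      ext1 v
      exact LinearMap.congr_fun h v
  refine ⟨M, M →₀ Op lam P, inferInstance, inferInstance, iR, iT, p', j, hF, hfree, ?_⟩
  obtain ⟨f, ⟨hf1, hf2⟩, -⟩ := hfree M inferInstance inferInstance inferInstance inferInstance p hp id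
  obtain ⟨β, hβ1, hβ2⟩ := hproj (M →₀ Op lam P) inferInstance inferInstance iR iT p' hF
    M inferInstance inferInstance inferInstance inferInstance p hp f hf1
    (fun m => ⟨j m, hf2 m⟩) LinearMap.id (fun _ => rfl)
  exact ⟨β, f, hβ1, hf1, hβ2⟩
end
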